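/- Let (G, P, L) be a minimum counterexample to the following statement, minimizing |V(G)| + |E(G)| and then the sum of the list sizes: 'Every plane graph G with no 4-cycle, with outer face F, subpath P ⊆ F with at most three vertices, and (*,1)-list assignment L satisfying conditions (i)–(vi) is L-colorable.' Then G contains no triangle whose interior (in the plane embedding) is nonempty. -/

import Mathlib

open Set

namespace ChoosSep

/-- `G` has a cycle of length `n`. -/
def HasCycleLen {V : Type} (G : SimpleGraph V) (n : ℕ) : Prop :=
  ∃ (v : V) (c : G.Walk v v), c.IsCycle ∧ c.length = n

/-- `G` has a proper coloring choosing each color from the list `L v`. -/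
def ColorableWith {V : Type} (G : SimpleGraph V) (L : V → Finset ℕ) : Prop :=
  ∃ φ : V → ℕ, (∀ v, φ v ∈ L v) ∧ ∀ ⦃u v⦄, G.Adj u v → φ u ≠ φ v

/-- `G` is `(k,d)`-choosable: it has an `L`-coloring for every list assignment
giving each vertex at least `k` colors and any two adjacent vertices at most `d`
common colors. -/
def Choosable {V : Type} (G : SimpleGraph V) (k d : ℕ) : Prop :=
  ∀ L : V → Finset ℕ, (∀ v, k ≤ (L v).card) →
    (∀ ⦃u v⦄, G.Adj u v → ((L u) ∩ (L v)).card ≤ d) →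
    ColorableWith G L

/-- The closed straight segment between two points of the plane. -/
def seg (x y : ℝ × ℝ) : Set (ℝ × ℝ) := segment ℝ x y

/-- A straight-line plane embedding of `G`: vertices go to distinct points, edges are
drawn as straight segments, two distinct edges meet only in common endpoints, and no
vertex lies on the drawing of an edge it does not belong to.  By Fáry's theorem a
finite simple graph admits such an embedding iff it is planar. -/
structure PlaneEmb {V : Type} (G : SimpleGraph V) where
  pos : V → ℝ × ℝ
  inj : Function.Injective pos
  edges_meet : ∀ ⦃a b c d : V⦄, G.Adj a b → G.Adj c d → s(a, b) ≠ s(c, d) →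
    seg (pos a) (pos b) ∩ seg (pos c) (pos d) ⊆ ({pos a, pos b} ∩ {pos c, pos d} : Set (ℝ × ℝ))
  vertex_off : ∀ ⦃a b v : V⦄, G.Adj a b → v ≠ a → v ≠ b → pos v ∉ seg (pos a) (pos b)

/-- `G` is planar: it admits a plane embedding. -/
def IsPlanar {V : Type} (G : SimpleGraph V) : Prop := Nonempty (PlaneEmb G)

variable {V : Type} {G : SimpleGraph V}

/-- The drawing of the graph in the plane: all vertex points and all edge segments. -/
def PlaneEmb.drawing (E : PlaneEmb G) : Set (ℝ × ℝ) :=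
  Set.range E.pos ∪ ⋃ (a : V) (b : V) (_ : G.Adj a b), seg (E.pos a) (E.pos b)

/-- A face of the embedding: a connected component of the complement of the drawing. -/
def PlaneEmb.IsFace (E : PlaneEmb G) (C : Set (ℝ × ℝ)) : Prop :=
  ∃ q, q ∉ E.drawing ∧ C = connectedComponentIn E.drawingᶜ q

/-- The outer face: the unbounded face. -/
def PlaneEmb.IsOuterFace (E : PlaneEmb G) (C : Set (ℝ × ℝ)) : Prop :=
  E.IsFace C ∧ ¬ Bornology.IsBounded C

/-- The vertices lying on the boundary of the face `C`. -/
def PlaneEmb.onFace (E : PlaneEmb G) (C : Set (ℝ × ℝ)) : Set V :=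
  {v | E.pos v ∈ closure C}

/-- An edge of `G` lying on the boundary of the face `C`. -/
def PlaneEmb.BoundaryEdge (E : PlaneEmb G) (C : Set (ℝ × ℝ)) (u v : V) : Prop :=
  G.Adj u v ∧ seg (E.pos u) (E.pos v) ⊆ closure C

/-- `C` is a 3-face with (mutually adjacent) incident vertices `x`, `y`, `z`. -/
def PlaneEmb.IsTriFace (E : PlaneEmb G) (C : Set (ℝ × ℝ)) (x y z : V) : Prop :=
  E.IsFace C ∧ G.Adj x y ∧ G.Adj y z ∧ G.Adj x z ∧
    frontier C = seg (E.pos x) (E.pos y) ∪ seg (E.pos y) (E.pos z) ∪ seg (E.pos x) (E.pos z)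

/-- `C` is a 4-face with incident 4-cycle `w x y z`. -/
def PlaneEmb.IsQuadFace (E : PlaneEmb G) (C : Set (ℝ × ℝ)) (w x y z : V) : Prop :=
  E.IsFace C ∧ G.Adj w x ∧ G.Adj x y ∧ G.Adj y z ∧ G.Adj z w ∧ w ≠ y ∧ x ≠ z ∧
    frontier C = seg (E.pos w) (E.pos x) ∪ seg (E.pos x) (E.pos y) ∪
      seg (E.pos y) (E.pos z) ∪ seg (E.pos z) (E.pos w)

/-- `x z1 y z2` is a diamond: a 4-cycle formed by two adjacent 3-faces
`x y z1` and `x y z2` sharing the edge `x y`. -/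
def PlaneEmb.IsDiamond (E : PlaneEmb G) (x z1 y z2 : V) : Prop :=
  z1 ≠ z2 ∧ ∃ C1 C2 : Set (ℝ × ℝ), C1 ≠ C2 ∧ E.IsTriFace C1 x y z1 ∧ E.IsTriFace C2 x y z2

/-- The union of the three sides of the triangle `a b c`. -/
def triBoundary (a b c : ℝ × ℝ) : Set (ℝ × ℝ) := seg a b ∪ seg b c ∪ seg a c

/-- The open interior region of the triangle `a b c`: points off the triangle whose
connected component in the complement of the triangle is bounded. -/
def triInterior (a b c : ℝ × ℝ) : Set (ℝ × ℝ) :=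
  {p | p ∉ triBoundary a b c ∧
    Bornology.IsBounded (connectedComponentIn (triBoundary a b c)ᶜ p)}

/-- The degree of a vertex. -/
noncomputable def deg (G : SimpleGraph V) (v : V) : ℕ := Nat.card {u : V // G.Adj v u}

/-- `G` is 2-connected: connected and with no cutvertex. -/
def TwoConnected (G : SimpleGraph V) : Prop :=
  G.Connected ∧ ∀ v : V, (G.induce {u : V | u ≠ v}).Connected

/-- A configuration for Theorem 6: a plane graph with no 4-cycle, outer face `F`, a
precolored subpath `P` of the outer face with at most three vertices, and a
`(*,1)`-list assignment `L` satisfying conditions (i)–(vi). -/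
structure Cfg4 where
  n : ℕ
  G : SimpleGraph (Fin n)
  E : PlaneEmb G
  F : Set (ℝ × ℝ)
  P : List (Fin n)
  L : Fin n → Finset ℕ

namespace Cfg4

/-- All hypotheses of Theorem 6 hold for the configuration. -/
def Valid (C : Cfg4) : Prop :=
  (¬ HasCycleLen C.G 4) ∧
  C.E.IsOuterFace C.F ∧
  C.P.Nodup ∧ C.P.length ≤ 3 ∧
  (∀ v ∈ C.P, v ∈ C.E.onFace C.F) ∧
  C.P.Chain' (C.E.BoundaryEdge C.F) ∧
  (∀ v, 1 ≤ (C.L v).card) ∧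
  (∀ ⦃u v⦄, C.G.Adj u v → ((C.L u) ∩ (C.L v)).card ≤ 1) ∧
  (∀ v, v ∉ C.E.onFace C.F → 3 ≤ (C.L v).card) ∧
  (∀ v ∈ C.E.onFace C.F, v ∉ C.P → 2 ≤ (C.L v).card) ∧
  (∀ v ∈ C.P, (C.L v).card = 1) ∧
  (∀ ⦃u v⦄, C.G.Adj u v → (C.L u).card = 2 → (C.L v).card ≠ 2) ∧
  (∃ φ : Fin C.n → ℕ, (∀ v ∈ C.P, φ v ∈ C.L v) ∧
    ∀ ⦃u v⦄, u ∈ C.P → v ∈ C.P → C.G.Adj u v → φ u ≠ φ v) ∧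
  (∀ x, (C.L x).card = 2 → ∀ u ∈ C.P, ∀ v ∈ C.P, u ≠ v →
    C.G.Adj x u → C.G.Adj x v → False)

/-- The configuration admits an `L`-coloring. -/
def Colorable (C : Cfg4) : Prop := ColorableWith C.G C.L

/-- The quantity `|V(G)| + |E(G)|`. -/
noncomputable def measure (C : Cfg4) : ℕ := C.n + Nat.card ↥C.G.edgeSet

/-- The sum of the sizes of the lists. -/
def listSum (C : Cfg4) : ℕ := ∑ v, (C.L v).card

/-- `C` is a minimum counterexample to Theorem 6: it satisfies the hypotheses, has no
`L`-coloring, and minimizes `|V(G)| + |E(G)|` and then the sum of the list sizes among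
all such counterexamples. -/
def MinCounterexample (C : Cfg4) : Prop :=
  C.Valid ∧ ¬ C.Colorable ∧
    ∀ D : Cfg4, D.Valid → ¬ D.Colorable →
      C.measure ≤ D.measure ∧ (D.measure = C.measure → C.listSum ≤ D.listSum)

/-- `uv` is a chord of the outer cycle: an edge between two vertices of the outer
face that is not an edge of the outer face. -/
def IsChord (C : Cfg4) (u v : Fin C.n) : Prop :=
  C.G.Adj u v ∧ u ∈ C.E.onFace C.F ∧ v ∈ C.E.onFace C.F ∧ ¬ C.E.BoundaryEdge C.F u v

/-- A chord `uv` is bad if one of its `Q`-components is a triangle `u v x` with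
`|L(x)| = 2`: i.e. there is an `L2`-vertex `x` with `ux` and `xv` edges of the outer
cycle such that the triangle `u x v` encloses no vertex of `G`. -/
def IsBadChord (C : Cfg4) (u v : Fin C.n) : Prop :=
  C.IsChord u v ∧ ∃ x : Fin C.n, (C.L x).card = 2 ∧
    C.G.Adj u x ∧ C.G.Adj x v ∧
    C.E.BoundaryEdge C.F u x ∧ C.E.BoundaryEdge C.F x v ∧
    ∀ w : Fin C.n, C.E.pos w ∉ triInterior (C.E.pos u) (C.E.pos x) (C.E.pos v)

/-- `v0 v1 v2` is a 2-chord of the outer cycle. -/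
def Is2Chord (C : Cfg4) (v0 v1 v2 : Fin C.n) : Prop :=
  C.G.Adj v0 v1 ∧ C.G.Adj v1 v2 ∧ v0 ≠ v2 ∧
    v0 ∈ C.E.onFace C.F ∧ v2 ∈ C.E.onFace C.F ∧ v1 ∉ C.E.onFace C.F

/-- A 2-chord `v0 v1 v2` is separating if `v0 v2` is not an edge of the outer cycle. -/
def IsSep2Chord (C : Cfg4) (v0 v1 v2 : Fin C.n) : Prop :=
  C.Is2Chord v0 v1 v2 ∧ ¬ C.E.BoundaryEdge C.F v0 v2

/-- `v` is a middle vertex: it has degree two in the path `P`. -/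
def IsMiddle (C : Cfg4) (v : Fin C.n) : Prop :=
  ∃ a b, C.P = [a, v, b]

/-- `v0 v1 v2` is a path on the outer cycle `F`. -/
def IsOuterPath (C : Cfg4) (v0 v1 v2 : Fin C.n) : Prop :=
  v0 ≠ v2 ∧ C.E.BoundaryEdge C.F v0 v1 ∧ C.E.BoundaryEdge C.F v1 v2

end Cfg4

lemma isPreconnected_compl_of_convex_of_isBounded {E : Type*} [NormedAddCommGroup E]
    [NormedSpace ℝ E] (hE : 1 < Module.rank ℝ E) {K : Set E} (hK : Convex ℝ K)
    (hb : Bornology.IsBounded K) : IsPreconnected Kᶜ := by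
  rcases K.eq_empty_or_nonempty with rfl | ⟨c, hc⟩
  · simpa using isPreconnected_univ
  obtain ⟨r, hr⟩ := hb.subset_closedBall c
  have hr0 : 0 ≤ r := by simpa using dist_nonneg.trans (Metric.mem_closedBall.1 (hr hc))
  set A : Set E := (fun v : E => c + (1 + r / ‖v‖) • v) '' {0}ᶜ with hA
  have hApre : IsPreconnected A := by
    refine (isConnected_compl_singleton_of_one_lt_rank hE 0).isPreconnected.image _ ?_
    intro v hv
    have hv' : ‖v‖ ≠ 0 := norm_ne_zero_iff.2 hv
    have : ContinuousAt (fun v : E => c + (1 + r / ‖v‖) • v) v := by fun_prop (disch := assumption)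
    exact this.continuousWithinAt
  have hnorm : ∀ v : E, v ≠ 0 → ‖(1 + r / ‖v‖) • v‖ = ‖v‖ + r := by
    intro v hv
    have hv' : 0 < ‖v‖ := norm_pos_iff.2 hv
    rw [norm_smul, Real.norm_of_nonneg (by positivity)]
    field_simp
  have hAK : A ⊆ Kᶜ := by
    rintro _ ⟨v, hv, rfl⟩ hvK
    have hv' : 0 < ‖v‖ := norm_pos_iff.2 hv
    have := hr hvK
    rw [Metric.mem_closedBall, dist_eq_norm, add_sub_cancel_left, hnorm v hv] at this
    linarith
  have hray : ∀ p ∈ Kᶜ, ∃ p' ∈ A, segment ℝ p p' ⊆ Kᶜ := by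
    intro p hp
    have hpc : p - c ≠ 0 := fun h => hp (by rwa [sub_eq_zero.1 h])
    have hpos : 0 < ‖p - c‖ := norm_pos_iff.2 hpc
    refine ⟨c + (1 + r / ‖p - c‖) • (p - c), ⟨p - c, hpc, rfl⟩, ?_⟩
    rintro q ⟨s, t, hs, ht, hst, rfl⟩ hq
    have ha : 0 ≤ t * (r / ‖p - c‖) := by positivity
    have hq' : s • p + t • (c + (1 + r / ‖p - c‖) • (p - c)) =
        c + (1 + t * (r / ‖p - c‖)) • (p - c) := by
      obtain rfl : s = 1 - t := by linarith
      module
    rw [hq'] at hq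
    set a := t * (r / ‖p - c‖)
    refine hp ?_
    have h1 : (0 : ℝ) < 1 + a := by linarith
    have := hK hc hq (a := a / (1 + a)) (b := 1 / (1 + a)) (by positivity) (by positivity)
      (by field_simp; ring)
    convert this using 1
    have h2 : a / (1 + a) + 1 / (1 + a) = 1 := by field_simp; ring
    have h3 : 1 / (1 + a) * (1 + a) = 1 := by field_simp
    rw [smul_add, smul_smul, h3, ← add_assoc, ← add_smul, h2]
    module
  refine isPreconnected_of_forall_pair fun p hp q hq => ?_
  obtain ⟨p', hp'A, hp'⟩ := hray p hp
  obtain ⟨q', hq'A, hq'⟩ := hray q hq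
  refine ⟨segment ℝ p p' ∪ A ∪ segment ℝ q q', ?_, ?_, ?_, ?_⟩
  · exact union_subset (union_subset hp' hAK) hq'
  · exact Or.inl (Or.inl (left_mem_segment ℝ p p'))
  · exact Or.inr (left_mem_segment ℝ q q')
  · refine IsPreconnected.union q' (Or.inr hq'A) (right_mem_segment ℝ q q') ?_
      (convex_segment q q').isPreconnected
    exact IsPreconnected.union p' (right_mem_segment ℝ p p') hp'A
      (convex_segment p p').isPreconnected hApre

lemma isPreconnected_compl_convexHull_triple (a b c : ℝ × ℝ) :
    IsPreconnected (convexHull ℝ {a, b, c})ᶜ :=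
  isPreconnected_compl_of_convex_of_isBounded (by simp; norm_num) (convex_convexHull ℝ _)
    (isBounded_convexHull.2 (toFinite _).isBounded)

lemma not_isBounded_compl_convexHull_triple (a b c : ℝ × ℝ) :
    ¬ Bornology.IsBounded (convexHull ℝ {a, b, c})ᶜ := by
  intro h
  have h' := h.union (isBounded_convexHull.2 (toFinite {a, b, c}).isBounded)
  rw [compl_union_self] at h'
  exact NormedSpace.unbounded_univ ℝ (ℝ × ℝ) h'

lemma triBoundary_subset_convexHull (a b c : ℝ × ℝ) :
    triBoundary a b c ⊆ convexHull ℝ {a, b, c} := by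
  refine union_subset (union_subset ?_ ?_) ?_ <;>
    exact segment_subset_convexHull (by simp) (by simp)

lemma triInterior_subset_convexHull (a b c : ℝ × ℝ) :
    triInterior a b c ⊆ convexHull ℝ {a, b, c} := by
  rintro p ⟨-, hb⟩
  by_contra hp
  exact not_isBounded_compl_convexHull_triple a b c <| hb.subset <|
    (isPreconnected_compl_convexHull_triple a b c).subset_connectedComponentIn hp
      (compl_subset_compl.2 (triBoundary_subset_convexHull a b c))

lemma isClosed_triBoundary (a b c : ℝ × ℝ) : IsClosed (triBoundary a b c) := by
  have h : ∀ p q : ℝ × ℝ, IsClosed (seg p q) := fun p q => by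
    rw [seg, ← convexHull_pair]
    exact (toFinite {p, q}).isClosed_convexHull ℝ
  exact ((h a b).union (h b c)).union (h a c)

lemma connectedComponentIn_subset_triInterior {a b c p : ℝ × ℝ} (hp : p ∈ triInterior a b c) :
    connectedComponentIn (triBoundary a b c)ᶜ p ⊆ triInterior a b c := fun _ hq =>
  ⟨connectedComponentIn_subset _ _ hq, connectedComponentIn_eq hq ▸ hp.2⟩

lemma isOpen_triInterior (a b c : ℝ × ℝ) : IsOpen (triInterior a b c) := by
  refine isOpen_iff_mem_nhds.2 fun p hp => ?_
  exact Filter.mem_of_superset ((isClosed_triBoundary a b c).isOpen_compl.connectedComponentIn.mem_nhds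
    (mem_connectedComponentIn hp.1)) (connectedComponentIn_subset_triInterior hp)

lemma disjoint_triInterior_closure {a b c : ℝ × ℝ} {F : Set (ℝ × ℝ)} (hF : IsPreconnected F)
    (hb : ¬ Bornology.IsBounded F) (hd : F ⊆ (triBoundary a b c)ᶜ) :
    Disjoint (triInterior a b c) (closure F) := by
  refine Disjoint.closure_right ?_ (isOpen_triInterior a b c)
  rw [Set.disjoint_left]
  intro p hp hpF
  exact hb (hp.2.subset (hF.subset_connectedComponentIn hpF hd))

lemma exists_mem_triBoundary_of_mem_triInterior {a b c p q : ℝ × ℝ}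
    (hp : p ∈ triInterior a b c) (hq : q ∉ triInterior a b c) :
    ∃ r ∈ seg p q, r ∈ triBoundary a b c := by
  by_contra! h
  exact hq <| connectedComponentIn_subset_triInterior hp <|
    (convex_segment p q).isPreconnected.subset_connectedComponentIn (left_mem_segment ℝ p q) h
      (right_mem_segment ℝ p q)

lemma seg_subset_closure_compl_convexHull {a b c : ℝ × ℝ}
    (h : ¬ Collinear ℝ {a, b, c}) : seg a b ⊆ closure (convexHull ℝ {a, b, c})ᶜ := by
  set l : ℝ × ℝ → ℝ := fun q => (b.1 - a.1) * (q.2 - a.2) - (b.2 - a.2) * (q.1 - a.1) with hl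
  have hd : l c ≠ 0 := by
    intro h0
    apply h
    by_cases hab : a = b
    · subst hab
      simpa using collinear_pair ℝ a c
    refine (collinear_iff_of_mem (p₀ := a) (by simp)).2 ⟨b - a, ?_⟩
    rintro p (rfl | rfl | rfl)
    · exact ⟨0, by simp⟩
    · exact ⟨1, by simp⟩
    · simp only [hl] at h0
      by_cases h1 : b.1 - a.1 = 0
      · have h2 : b.2 - a.2 ≠ 0 := fun h2 =>
          hab (Prod.ext (sub_eq_zero.1 h1).symm (sub_eq_zero.1 h2).symm)
        refine ⟨(p.2 - a.2) / (b.2 - a.2), Prod.ext ?_ ?_⟩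
        · have : p.1 - a.1 = 0 := by simpa [h1, h2] using h0
          simp [h1]; linarith
        · simp; field_simp; ring
      · refine ⟨(p.1 - a.1) / (b.1 - a.1), Prod.ext ?_ ?_⟩
        · simp; field_simp; ring
        · simp; field_simp; linarith
  have hsub : convexHull ℝ {a, b, c} ⊆ {q | 0 ≤ l c * l q} := by
    refine convexHull_min ?_ ?_
    · rintro p (rfl | rfl | rfl)
      · simp [hl]
      · simp only [hl, mem_ofPred_eq]; ring_nf; rfl
      · exact mul_self_nonneg (l _)
    · intro u hu v hv s t hs ht hst
      simp only [mem_ofPred_eq] at hu hv ⊢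
      obtain rfl : s = 1 - t := by linarith
      have : l ((1 - t) • u + t • v) = (1 - t) * l u + t * l v := by
        simp [hl]; ring
      rw [this]
      nlinarith [mul_nonneg hs hu, mul_nonneg ht hv]
  rintro p ⟨s, t, hs, ht, hst, rfl⟩
  set p := s • a + t • b with hp
  have hlp : l p = 0 := by
    obtain rfl : s = 1 - t := by linarith
    simp [hl, hp]; ring
  have htend : Filter.Tendsto (fun e : ℝ => p + e • (p - c)) (nhdsWithin 0 (Ioi 0)) (nhds p) := by
    have : Continuous fun e : ℝ => p + e • (p - c) := by fun_prop
    simpa using (this.tendsto 0).mono_left nhdsWithin_le_nhds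
  refine mem_closure_of_tendsto htend ?_
  filter_upwards [self_mem_nhdsWithin] with e he hmem
  have h1 : l (p + e • (p - c)) = l p + e * (l p - l c) := by
    simp [hl]; ring
  have h2 : 0 ≤ l c * l (p + e • (p - c)) := hsub hmem
  rw [h1, hlp] at h2
  have h3 : 0 < e * (l c * l c) := mul_pos he (mul_self_pos.2 hd)
  nlinarith

/-- Restriction of a plane embedding along an injective graph homomorphism. -/
def PlaneEmb.comap {W : Type} {H : SimpleGraph W} (E : PlaneEmb G) (f : H →g G)
    (hf : Function.Injective f) : PlaneEmb H where
  pos := E.pos ∘ f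
  inj := E.inj.comp hf
  edges_meet := fun _ _ _ _ hab hcd hne => E.edges_meet (f.map_adj hab) (f.map_adj hcd)
    fun h => hne (Sym2.map.injective hf (by simpa using h))
  vertex_off := fun _ _ _ hab ha hb => E.vertex_off (f.map_adj hab) (hf.ne ha) (hf.ne hb)

lemma PlaneEmb.drawing_comap_subset {W : Type} {H : SimpleGraph W} (E : PlaneEmb G) (f : H →g G)
    (hf : Function.Injective f) : (E.comap f hf).drawing ⊆ E.drawing := by
  rintro p (⟨v, rfl⟩ | hp)
  · exact Or.inl ⟨f v, rfl⟩
  · simp only [mem_iUnion] at hp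
    obtain ⟨a, b, hab, hp⟩ := hp
    exact Or.inr (by simpa only [mem_iUnion] using ⟨f a, f b, f.map_adj hab, hp⟩)

lemma PlaneEmb.drawing_subset_of_convex (E : PlaneEmb G) {K : Set (ℝ × ℝ)} (hK : Convex ℝ K)
    (h : ∀ v, E.pos v ∈ K) : E.drawing ⊆ K := by
  rintro p (⟨v, rfl⟩ | hp)
  · exact h v
  · simp only [mem_iUnion] at hp
    obtain ⟨a, b, -, hp⟩ := hp
    exact hK.segment_subset (h a) (h b) hp

lemma PlaneEmb.triBoundary_subset_drawing (E : PlaneEmb G) {x y z : V} (hxy : G.Adj x y)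
    (hyz : G.Adj y z) (hxz : G.Adj x z) :
    triBoundary (E.pos x) (E.pos y) (E.pos z) ⊆ E.drawing := by
  rintro p ((hp | hp) | hp) <;> refine Or.inr ?_ <;> simp only [mem_iUnion]
  exacts [⟨x, y, hxy, hp⟩, ⟨y, z, hyz, hp⟩, ⟨x, z, hxz, hp⟩]

lemma PlaneEmb.not_collinear (E : PlaneEmb G) {x y z : V} (hxy : G.Adj x y)
    (hyz : G.Adj y z) (hxz : G.Adj x z) :
    ¬ Collinear ℝ {E.pos x, E.pos y, E.pos z} := by
  intro h
  rcases h.wbtw_or_wbtw_or_wbtw with h | h | h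
  · exact E.vertex_off hxz hxy.ne' hyz.ne (mem_segment_iff_wbtw.2 h)
  · exact E.vertex_off hxy.symm hyz.ne' hxz.ne' (mem_segment_iff_wbtw.2 h)
  · exact E.vertex_off hyz.symm hxz.ne hxy.ne (mem_segment_iff_wbtw.2 h)

/-- An edge leaving the interior of a triangle of the graph ends at a corner of the triangle. -/
lemma PlaneEmb.eq_corner_of_adj (E : PlaneEmb G) {x y z u v : V} (hxy : G.Adj x y)
    (hyz : G.Adj y z) (hxz : G.Adj x z) (huv : G.Adj u v)
    (hu : E.pos u ∈ triInterior (E.pos x) (E.pos y) (E.pos z))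
    (hv : E.pos v ∉ triInterior (E.pos x) (E.pos y) (E.pos z)) : v = x ∨ v = y ∨ v = z := by
  have key : ∀ a b, G.Adj a b →
      seg (E.pos a) (E.pos b) ⊆ triBoundary (E.pos x) (E.pos y) (E.pos z) →
      ∀ r ∈ seg (E.pos u) (E.pos v), r ∈ seg (E.pos a) (E.pos b) → v = a ∨ v = b := by
    intro a b hab hsub r hr hr'
    have hua : u ≠ a := by
      rintro rfl
      exact hu.1 (hsub (left_mem_segment ℝ _ _))
    have hub : u ≠ b := by
      rintro rfl
      exact hu.1 (hsub (right_mem_segment ℝ _ _))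
    obtain ⟨h1, h2⟩ := E.edges_meet huv hab (by simp [hua, hub]) ⟨hr, hr'⟩
    rcases h1 with rfl | rfl
    · exact absurd (hsub hr') hu.1
    · rcases h2 with h2 | h2
      · exact Or.inl (E.inj h2)
      · exact Or.inr (E.inj h2)
  obtain ⟨r, hr, (hr' | hr') | hr'⟩ := exists_mem_triBoundary_of_mem_triInterior hu hv
  · have := key x y hxy (fun _ h => Or.inl (Or.inl h)) r hr hr'
    tauto
  · have := key y z hyz (fun _ h => Or.inl (Or.inr h)) r hr hr'
    tauto
  · have := key x z hxz (fun _ h => Or.inr h) r hr hr'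
    tauto

lemma HasCycleLen.map {W : Type} {H : SimpleGraph W} {k : ℕ} (f : H →g G)
    (hf : Function.Injective f) : HasCycleLen H k → HasCycleLen G k := by
  rintro ⟨v, c, hc, rfl⟩
  exact ⟨f v, c.map f, hc.map hf, by simp⟩

lemma card_edgeSet_le {W : Type} {H : SimpleGraph W} [Finite V] (f : H →g G)
    (hf : Function.Injective f) : Nat.card H.edgeSet ≤ Nat.card G.edgeSet :=
  Nat.card_le_card_of_injective _ (SimpleGraph.Hom.mapEdgeSet.injective f hf)

lemma exists_embedding_fin_range {n : ℕ} (S : Set (Fin n)) :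
    ∃ (m : ℕ) (f : Fin m ↪ Fin n), range f = S :=
  ⟨_, (Finite.equivFin S).symm.toEmbedding.trans (Function.Embedding.subtype _), by
    ext v
    exact ⟨by rintro ⟨i, rfl⟩; exact ((Finite.equivFin S).symm i).2,
      fun h => ⟨Finite.equivFin S ⟨v, h⟩,
        congrArg Subtype.val ((Finite.equivFin S).symm_apply_apply ⟨v, h⟩)⟩⟩⟩

namespace Cfg4

lemma MinCounterexample.colorable_of_measure_lt {C D : Cfg4} (hC : C.MinCounterexample)
    (hD : D.Valid) (h : D.measure < C.measure) : D.Colorable := by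
  by_contra hcol
  exact absurd (hC.2.2 D hD hcol).1 (not_le.2 h)

/-- In a minimum counterexample, every proper induced subgraph containing the precolored path
is colorable. -/
lemma MinCounterexample.exists_coloring_on {C : Cfg4} (hC : C.MinCounterexample)
    {S : Set (Fin C.n)} (hS : S ≠ univ) (hP : ∀ v ∈ C.P, v ∈ S) :
    ∃ φ : Fin C.n → ℕ, (∀ v ∈ S, φ v ∈ C.L v) ∧
      ∀ u ∈ S, ∀ v ∈ S, C.G.Adj u v → φ u ≠ φ v := by
  obtain ⟨m, f, rfl⟩ := exists_embedding_fin_range S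
  have hP' : C.P ∈ range (List.map f) := by
    rw [Set.range_list_map]
    exact hP
  obtain ⟨P', hP'⟩ := hP'
  have hmem : ∀ v, v ∈ P' ↔ f v ∈ C.P := fun v => by
    rw [← hP', List.mem_map_of_injective f.injective]
  obtain ⟨h4, ⟨⟨q, hq, hF⟩, hunb⟩, hnodup, hlen, hPF, hchain, h1, hsep, h3, h2, hone, hL2, hpre,
    htwo⟩ := hC.1
  let g : C.G.comap f →g C.G := ⟨f, fun h => h⟩
  let E' : PlaneEmb (C.G.comap f) := C.E.comap g f.injective
  have hsub : E'.drawing ⊆ C.E.drawing := C.E.drawing_comap_subset g f.injective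
  let F' := connectedComponentIn E'.drawingᶜ q
  have hFF : C.F ⊆ F' := by
    rw [hF]
    exact connectedComponentIn_mono q (compl_subset_compl.2 hsub)
  have hcl : closure C.F ⊆ closure F' := closure_mono hFF
  let D : Cfg4 := ⟨m, C.G.comap f, E', F', P', C.L ∘ f⟩
  have hD : D.Valid := by
    refine ⟨fun h => h4 (h.map g f.injective), ⟨⟨q, fun h => hq (hsub h), rfl⟩,
      fun h => hunb (h.subset hFF)⟩, ?_, ?_, ?_, ?_, fun v => h1 (f v), fun u v h => hsep h,
      fun v hv => h3 (f v) fun h => hv (hcl h), ?_, ?_, fun u v h => hL2 h, ?_, ?_⟩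
    · exact List.Nodup.of_map f (hP' ▸ hnodup)
    · rw [← hP'] at hlen
      simpa using hlen
    · exact fun v hv => hcl (hPF (f v) ((hmem v).1 hv))
    · rw [← hP'] at hchain
      exact ((List.isChain_map f).1 hchain).imp fun a b h => ⟨h.1, h.2.trans hcl⟩
    · intro v _ hvP
      by_cases hv : f v ∈ C.E.onFace C.F
      · exact h2 (f v) hv fun h => hvP ((hmem v).2 h)
      · exact (h3 (f v) hv).trans' (by norm_num)
    · exact fun v hv => hone (f v) ((hmem v).1 hv)
    · obtain ⟨φ, hφ, hφ'⟩ := hpre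
      exact ⟨φ ∘ f, fun v hv => hφ (f v) ((hmem v).1 hv),
        fun u v hu hv h => hφ' ((hmem u).1 hu) ((hmem v).1 hv) h⟩
    · exact fun x hx u hu v hv huv => htwo (f x) hx (f u) ((hmem u).1 hu) (f v) ((hmem v).1 hv)
        (f.injective.ne huv)
  have hlt : D.measure < C.measure := by
    refine Nat.add_lt_add_of_lt_of_le ?_ (card_edgeSet_le g f.injective)
    simpa using Fintype.card_lt_of_injective_not_surjective f f.injective
      fun h => hS h.range_eq
  obtain ⟨φ, hφ, hne⟩ := hC.colorable_of_measure_lt hD hlt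
  refine ⟨Function.extend f φ 0, ?_, ?_⟩
  · rintro _ ⟨v, rfl⟩
    rw [f.injective.extend_apply]
    exact hφ v
  · rintro _ ⟨u, rfl⟩ _ ⟨v, rfl⟩ huv
    rw [f.injective.extend_apply, f.injective.extend_apply]
    exact hne huv

/-- In a minimum counterexample, every proper precoloring of a triangle extends to the vertices
in the interior of the triangle. -/
lemma MinCounterexample.exists_extension_interior {C : Cfg4} (hC : C.MinCounterexample)
    {x y z : Fin C.n} (hxy : C.G.Adj x y) (hyz : C.G.Adj y z) (hxz : C.G.Adj x z)
    {c : Fin C.n → ℕ} (cxy : c x ≠ c y) (cyz : c y ≠ c z) (cxz : c x ≠ c z) :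
    ∃ φ : Fin C.n → ℕ, φ x = c x ∧ φ y = c y ∧ φ z = c z ∧
      (∀ v, C.E.pos v ∈ triInterior (C.E.pos x) (C.E.pos y) (C.E.pos z) → φ v ∈ C.L v) ∧
      ∀ u v, C.E.pos u ∈ triInterior (C.E.pos x) (C.E.pos y) (C.E.pos z) →
        C.G.Adj u v → φ u ≠ φ v := by
  set T := triInterior (C.E.pos x) (C.E.pos y) (C.E.pos z)
  have htri := C.E.triBoundary_subset_drawing hxy hyz hxz
  obtain ⟨h4, ⟨⟨q, hq, hF⟩, hunb⟩, -, -, -, -, -, hsep, h3, -⟩ := hC.1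
  have hdisj : Disjoint T (closure C.F) := by
    refine disjoint_triInterior_closure ?_ hunb ?_
    · rw [hF]
      exact isPreconnected_connectedComponentIn
    · rw [hF]
      exact (connectedComponentIn_subset _ _).trans (compl_subset_compl.2 htri)
  have hcard : ∀ v, C.E.pos v ∈ T → 3 ≤ (C.L v).card := fun v hv =>
    h3 v fun h => Set.disjoint_left.1 hdisj hv h
  have hxT : C.E.pos x ∉ T := fun h => h.1 (Or.inl (Or.inl (left_mem_segment ℝ _ _)))
  have hyT : C.E.pos y ∉ T := fun h => h.1 (Or.inl (Or.inr (left_mem_segment ℝ _ _)))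
  have hzT : C.E.pos z ∉ T := fun h => h.1 (Or.inr (right_mem_segment ℝ _ _))
  obtain ⟨m, f, hf⟩ := exists_embedding_fin_range {v | C.E.pos v ∈ T ∨ v = x ∨ v = y ∨ v = z}
  have hfmem : ∀ v, C.E.pos (f v) ∈ T ∨ f v = x ∨ f v = y ∨ f v = z := fun v =>
    hf.subset (mem_range_self v)
  obtain ⟨x', hx'⟩ : x ∈ range f := by simp [hf]
  obtain ⟨y', hy'⟩ : y ∈ range f := by simp [hf]
  obtain ⟨z', hz'⟩ : z ∈ range f := by simp [hf]
  have hcorner : ∀ v, C.E.pos (f v) ∈ T ∨ v ∈ [x', y', z'] := fun v => by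
    simpa [← hx', ← hy', ← hz'] using hfmem v
  have hnotT : ∀ v ∈ [x', y', z'], C.E.pos (f v) ∉ T := by
    simp [hx', hy', hz', hxT, hyT, hzT]
  have hcP : ∀ u ∈ [x', y', z'], ∀ v ∈ [x', y', z'], u ≠ v → c (f u) ≠ c (f v) := by
    simp [hx', hy', hz', cxy, cyz, cxz, cxy.symm, cyz.symm, cxz.symm]
  let G₀ := C.G.deleteEdges {s(x, z)}
  let H := G₀.comap f
  let g₀ : H →g G₀ := ⟨f, fun h => h⟩
  have hadj : ∀ u v, H.Adj u v ↔ C.G.Adj (f u) (f v) ∧ s(f u, f v) ≠ s(x, z) := by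
    intro u v
    simp [H, G₀, SimpleGraph.deleteEdges_adj]
  let g : H →g C.G := ⟨f, fun h => ((hadj _ _).1 h).1⟩
  let E' : PlaneEmb H := C.E.comap g f.injective
  set K := convexHull ℝ {C.E.pos x, C.E.pos y, C.E.pos z} with hK
  have hdraw : E'.drawing ⊆ K := by
    refine E'.drawing_subset_of_convex (convex_convexHull ℝ _) fun v => ?_
    rcases hfmem v with h | h
    · exact triInterior_subset_convexHull _ _ _ h
    · refine subset_convexHull ℝ _ ?_
      have : E'.pos v = C.E.pos (f v) := rfl
      rw [this]
      rcases h with h | h | h <;> simp [h]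
  have hKunb := not_isBounded_compl_convexHull_triple (C.E.pos x) (C.E.pos y) (C.E.pos z)
  obtain ⟨q, hq⟩ : (Kᶜ).Nonempty := by
    by_contra! h
    exact hKunb (by rw [← hK, h]; exact Bornology.isBounded_empty)
  let F' := connectedComponentIn E'.drawingᶜ q
  have hKF : Kᶜ ⊆ F' :=
    (isPreconnected_compl_convexHull_triple _ _ _).subset_connectedComponentIn hq
      (compl_subset_compl.2 hdraw)
  have hxyF : seg (C.E.pos x) (C.E.pos y) ⊆ closure F' :=
    (seg_subset_closure_compl_convexHull (C.E.not_collinear hxy hyz hxz)).trans (closure_mono hKF)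
  have hyzF : seg (C.E.pos y) (C.E.pos z) ⊆ closure F' := by
    refine (seg_subset_closure_compl_convexHull
      (C.E.not_collinear hyz hxz.symm hxy.symm)).trans (closure_mono ?_)
    rwa [show ({C.E.pos y, C.E.pos z, C.E.pos x} : Set (ℝ × ℝ)) =
      {C.E.pos x, C.E.pos y, C.E.pos z} by ext; simp; tauto]
  let L' : Fin m → Finset ℕ := fun v => if v ∈ [x', y', z'] then {c (f v)} else C.L (f v)
  have hLP : ∀ v ∈ [x', y', z'], L' v = {c (f v)} := fun v hv => if_pos hv
  have hLT : ∀ v ∉ [x', y', z'], L' v = C.L (f v) := fun v hv => if_neg hv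
  have hL3 : ∀ v ∉ [x', y', z'], 3 ≤ (L' v).card := fun v hv => by
    rw [hLT v hv]
    exact hcard _ ((hcorner v).resolve_right hv)
  have hL1 : ∀ v ∈ [x', y', z'], (L' v).card = 1 := fun v hv => by
    rw [hLP v hv, Finset.card_singleton]
  have hLne2 : ∀ v, (L' v).card ≠ 2 := fun v => by
    by_cases hv : v ∈ [x', y', z']
    · rw [hL1 v hv]; norm_num
    · have := hL3 v hv; omega
  have hPface : ∀ v ∈ [x', y', z'], v ∈ E'.onFace F' := by
    intro v hv
    have hpos : E'.pos v = C.E.pos (f v) := rfl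
    simp only [List.mem_cons, List.not_mem_nil, or_false] at hv
    simp only [PlaneEmb.onFace, mem_ofPred_eq, hpos]
    rcases hv with rfl | rfl | rfl
    · rw [hx']; exact hxyF (left_mem_segment ℝ _ _)
    · rw [hy']; exact hyzF (left_mem_segment ℝ _ _)
    · rw [hz']; exact hyzF (right_mem_segment ℝ _ _)
  let D : Cfg4 := ⟨m, H, E', F', [x', y', z'], L'⟩
  have hD : D.Valid := by
    refine ⟨fun h => h4 (h.map g f.injective), ⟨⟨q, fun h => hq (hdraw h), rfl⟩,
      fun h => hKunb (h.subset hKF)⟩, ?_, by simp [D], hPface, ?_, ?_, ?_, ?_, ?_, hL1,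
      fun u v _ hu => absurd hu (hLne2 u), ?_, fun v hv => absurd hv (hLne2 v)⟩
    · have h1 : x' ≠ y' := by rintro rfl; exact hxy.ne (hx'.symm.trans hy')
      have h2 : x' ≠ z' := by rintro rfl; exact hxz.ne (hx'.symm.trans hz')
      have h3 : y' ≠ z' := by rintro rfl; exact hyz.ne (hy'.symm.trans hz')
      simp [D, h1, h2, h3]
    · have hb1 : E'.BoundaryEdge F' x' y' := by
        refine ⟨(hadj _ _).2 ?_, ?_⟩
        · rw [hx', hy']
          exact ⟨hxy, by simp [hyz.ne, hxy.ne']⟩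
        · change seg (C.E.pos (f x')) (C.E.pos (f y')) ⊆ _
          rwa [hx', hy']
      have hb2 : E'.BoundaryEdge F' y' z' := by
        refine ⟨(hadj _ _).2 ?_, ?_⟩
        · rw [hy', hz']
          exact ⟨hyz, by simp [hyz.ne, hxy.ne']⟩
        · change seg (C.E.pos (f y')) (C.E.pos (f z')) ⊆ _
          rwa [hy', hz']
      exact .cons_cons hb1 (.cons_cons hb2 (.singleton _))
    · intro v
      change 1 ≤ (L' v).card
      by_cases hv : v ∈ [x', y', z']
      · exact (hL1 v hv).ge
      · exact (hL3 v hv).trans' (by norm_num)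
    · intro u v huv
      change (L' u ∩ L' v).card ≤ 1
      by_cases hu : u ∈ [x', y', z']
      · exact (Finset.card_le_card Finset.inter_subset_left).trans (hL1 u hu).le
      by_cases hv : v ∈ [x', y', z']
      · exact (Finset.card_le_card Finset.inter_subset_right).trans (hL1 v hv).le
      rw [hLT u hu, hLT v hv]
      exact hsep ((hadj u v).1 huv).1
    · exact fun v hv => hL3 v fun h => hv (hPface v h)
    · exact fun v _ hv => (hL3 v hv).trans' (by norm_num)
    · refine ⟨c ∘ f, fun v hv => ?_, fun u v hu hv huv => ?_⟩
      · change c (f v) ∈ L' v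
        rw [hLP v hv]
        exact Finset.mem_singleton_self _
      · exact hcP u hu v hv huv.ne
  have hlt : D.measure < C.measure := by
    refine Nat.add_lt_add_of_le_of_lt ?_ ?_
    · simpa using Fintype.card_le_of_embedding f
    · refine (card_edgeSet_le g₀ f.injective).trans_lt ?_
      refine Set.ncard_lt_ncard (SimpleGraph.edgeSet_ssubset_edgeSet.2 ?_) (toFinite _)
      refine lt_of_le_of_ne (SimpleGraph.deleteEdges_le _) fun h => ?_
      have : G₀.Adj x z := by
        rw [show G₀ = C.G from h]
        exact hxz
      simp [G₀, SimpleGraph.deleteEdges_adj] at this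
  obtain ⟨φ, hφ, hφ'⟩ := hC.colorable_of_measure_lt hD hlt
  have hφP : ∀ v ∈ [x', y', z'], φ v = c (f v) := fun v hv => by
    have h : φ v ∈ L' v := hφ v
    rwa [hLP v hv, Finset.mem_singleton] at h
  refine ⟨Function.extend f φ 0, ?_, ?_, ?_, ?_, ?_⟩
  · rw [← hx', f.injective.extend_apply, hφP x' (by simp)]
  · rw [← hy', f.injective.extend_apply, hφP y' (by simp)]
  · rw [← hz', f.injective.extend_apply, hφP z' (by simp)]
  · intro v hv
    obtain ⟨v, rfl⟩ : v ∈ range f := hf ▸ Or.inl hv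
    rw [f.injective.extend_apply, ← hLT v fun h => hnotT v h hv]
    exact hφ v
  · intro u v hu huv
    obtain ⟨v, rfl⟩ : v ∈ range f := by
      rw [hf]
      by_cases hv : C.E.pos v ∈ T
      · exact Or.inl hv
      · exact Or.inr (C.E.eq_corner_of_adj hxy hyz hxz huv hu hv)
    obtain ⟨u, rfl⟩ : u ∈ range f := hf ▸ Or.inl hu
    rw [f.injective.extend_apply, f.injective.extend_apply]
    refine hφ' ((hadj u v).2 ⟨huv, fun h => ?_⟩)
    have hmem : f u ∈ s(x, z) := h ▸ Sym2.mem_mk_left _ _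
    rcases Sym2.mem_iff.1 hmem with h | h
    · exact hxT (h ▸ hu)
    · exact hzT (h ▸ hu)

end Cfg4

/-- **Claim 4 in the proof of Theorem 6.** A minimum counterexample to Theorem 6
contains no triangle with nonempty interior (no triangle enclosing a vertex). -/
theorem min_cex_C4free_no_filled_triangle (C : Cfg4) (hC : C.MinCounterexample) :
    ¬ ∃ x y z w : Fin C.n, C.G.Adj x y ∧ C.G.Adj y z ∧ C.G.Adj x z ∧
      C.E.pos w ∈ triInterior (C.E.pos x) (C.E.pos y) (C.E.pos z) := by
  rintro ⟨x, y, z, w, hxy, hyz, hxz, hw⟩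
  set T := triInterior (C.E.pos x) (C.E.pos y) (C.E.pos z)
  have htri := C.E.triBoundary_subset_drawing hxy hyz hxz
  have hxT : C.E.pos x ∉ T := fun h => h.1 (Or.inl (Or.inl (left_mem_segment ℝ _ _)))
  have hyT : C.E.pos y ∉ T := fun h => h.1 (Or.inl (Or.inr (left_mem_segment ℝ _ _)))
  have hzT : C.E.pos z ∉ T := fun h => h.1 (Or.inr (right_mem_segment ℝ _ _))
  have hdisj : Disjoint T (closure C.F) := by
    obtain ⟨⟨q, hq, hF⟩, hunb⟩ := hC.1.2.1
    refine disjoint_triInterior_closure ?_ hunb ?_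
    · rw [hF]
      exact isPreconnected_connectedComponentIn
    · rw [hF]
      exact (connectedComponentIn_subset _ _).trans (compl_subset_compl.2 htri)
  obtain ⟨c, hc, hc'⟩ := hC.exists_coloring_on (S := {v | C.E.pos v ∉ T})
    (fun h => (h ▸ mem_univ w : w ∈ {v | C.E.pos v ∉ T}) hw)
    (fun v hv h => Set.disjoint_left.1 hdisj h (hC.1.2.2.2.2.1 v hv))
  obtain ⟨φ, hφx, hφy, hφz, hφ, hφ'⟩ := hC.exists_extension_interior hxy hyz hxz
    (hc' x hxT y hyT hxy) (hc' y hyT z hzT hyz) (hc' x hxT z hzT hxz)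
  have hcross : ∀ u v, C.E.pos u ∈ T → C.E.pos v ∉ T → C.G.Adj u v → φ u ≠ c v := by
    intro u v hu hv huv
    rcases C.E.eq_corner_of_adj hxy hyz hxz huv hu hv with rfl | rfl | rfl
    · exact hφx ▸ hφ' u _ hu huv
    · exact hφy ▸ hφ' u _ hu huv
    · exact hφz ▸ hφ' u _ hu huv
  classical
  refine hC.2.1 ⟨fun v => if C.E.pos v ∈ T then φ v else c v, fun v => ?_, fun u v huv => ?_⟩
  · by_cases hv : C.E.pos v ∈ T
    · simpa [hv] using hφ v hv
    · simpa [hv] using hc v hv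
  · by_cases hu : C.E.pos u ∈ T <;> by_cases hv : C.E.pos v ∈ T
    · simpa [hu, hv] using hφ' u v hu huv
    · simpa [hu, hv] using hcross u v hu hv huv
    · simpa [hu, hv] using (hcross v u hv hu huv.symm).symm
    · simpa [hu, hv] using hc' u hu v hv huv

end ChoosSep
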